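/- For any complex parameters α_0,…,α_5 with α_0+α_1+α_2+α_3+α_4+α_5 = 1, there is no rational solution (f_0,…,f_5) of A_5(α_0,…,α_5) such that for some i ∈ {0,…,5}, f_i, f_{i+1}, f_{i+4} have a pole at t=∞ and f_{i+2}, f_{i+3}, f_{i+5} are holomorphic at t=∞. -/

import Mathlib

open Filter Topology Polynomial

noncomputable section

/-- Evaluation of a complex rational function at a point (junk value where the
reduced denominator vanishes). -/
def evalR (f : RatFunc ℂ) (t : ℂ) : ℂ := RatFunc.eval (RingHom.id ℂ) t f

/-- `f` is defined at `t`: the reduced denominator does not vanish at `t`. -/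
def DefinedAt (f : RatFunc ℂ) (t : ℂ) : Prop := Polynomial.eval t (RatFunc.denom f) ≠ 0

/-- `(f 0, …, f 5)` is a rational solution of the `A₅⁽¹⁾` Painlevé system `A₅(α)`:
the two constraints hold identically as rational functions, and the six ODEs hold at
every point where all six components are defined.  (Indices are taken in `Fin 6`,
i.e. modulo `6`.) -/
def IsA5Solution (α : Fin 6 → ℂ) (f : Fin 6 → RatFunc ℂ) : Prop :=
  f 0 + f 2 + f 4 = RatFunc.X ∧
  f 1 + f 3 + f 5 = RatFunc.X ∧
  ∀ t : ℂ, (∀ j : Fin 6, DefinedAt (f j) t) → ∀ i : Fin 6,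
    t / 2 * deriv (evalR (f i)) t =
      evalR (f i) t *
        (evalR (f (i + 1)) t * evalR (f (i + 2)) t
          + evalR (f (i + 1)) t * evalR (f (i + 4)) t
          + evalR (f (i + 3)) t * evalR (f (i + 4)) t
          - evalR (f (i + 2)) t * evalR (f (i + 3)) t
          - evalR (f (i + 2)) t * evalR (f (i + 5)) t
          - evalR (f (i + 4)) t * evalR (f (i + 5)) t)
      + (1 / 2 - α (i + 2) - α (i + 4)) * evalR (f i) t
      + α i * (evalR (f (i + 2)) t + evalR (f (i + 4)) t)

/-- `f` has a pole at `t = ∞`: `‖f t‖ → ∞` as `‖t‖ → ∞`. -/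
def PoleAtInfty (f : RatFunc ℂ) : Prop :=
  Tendsto (fun t => ‖evalR f t‖) (Bornology.cobounded ℂ) atTop

/-- `f` is holomorphic at `t = ∞`: `f` is bounded as `‖t‖ → ∞`. -/
def HoloAtInfty (f : RatFunc ℂ) : Prop :=
  IsBoundedUnder (· ≤ ·) (Bornology.cobounded ℂ) fun t => ‖evalR f t‖

/-- `f` has a pole at `c ∈ ℂ`: `‖f t‖ → ∞` as `t → c`. -/
def PoleAt (f : RatFunc ℂ) (c : ℂ) : Prop :=
  Tendsto (fun t => ‖evalR f t‖) (𝓝[≠] c) atTop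

/-- `f` is regular at `c ∈ ℂ`: it extends continuously to `c`. -/
def RegularAt (f : RatFunc ℂ) (c : ℂ) : Prop :=
  ∃ L : ℂ, Tendsto (fun t => evalR f t) (𝓝[≠] c) (𝓝 L)

/-- `z` is an integer. -/
def IsInt (z : ℂ) : Prop := ∃ n : ℤ, z = (n : ℂ)

/-- `z` is an even integer. -/
def IsEvenInt (z : ℂ) : Prop := ∃ n : ℤ, z = 2 * (n : ℂ)

/-- A tuple of rational functions has pole configuration of Type A at `t = ∞`. -/
def TypeA (f : Fin 6 → RatFunc ℂ) : Prop :=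
  ∃ i : Fin 6,
    (PoleAtInfty (f i) ∧ PoleAtInfty (f (i + 1)) ∧ HoloAtInfty (f (i + 2)) ∧
      HoloAtInfty (f (i + 3)) ∧ HoloAtInfty (f (i + 4)) ∧ HoloAtInfty (f (i + 5))) ∨
    (PoleAtInfty (f i) ∧ PoleAtInfty (f (i + 3)) ∧ HoloAtInfty (f (i + 1)) ∧
      HoloAtInfty (f (i + 2)) ∧ HoloAtInfty (f (i + 4)) ∧ HoloAtInfty (f (i + 5))) ∨
    (PoleAtInfty (f i) ∧ PoleAtInfty (f (i + 1)) ∧ PoleAtInfty (f (i + 2)) ∧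
      PoleAtInfty (f (i + 4)) ∧ HoloAtInfty (f (i + 3)) ∧ HoloAtInfty (f (i + 5)))

/-- A tuple of rational functions has pole configuration of Type B at `t = ∞`. -/
def TypeB (f : Fin 6 → RatFunc ℂ) : Prop :=
  ∃ i : Fin 6,
    PoleAtInfty (f i) ∧ PoleAtInfty (f (i + 1)) ∧ PoleAtInfty (f (i + 2)) ∧
    PoleAtInfty (f (i + 3)) ∧ HoloAtInfty (f (i + 4)) ∧ HoloAtInfty (f (i + 5))

theorem Polynomial.eventually_cobounded_eval_ne_zero {p : ℂ[X]} (hp : p ≠ 0) :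
    ∀ᶠ t in Bornology.cobounded ℂ, p.eval t ≠ 0 := by
  have hfin : {t : ℂ | p.eval t = 0}.Finite := Polynomial.finite_setOfPred_isRoot hp
  exact hfin.isBounded

theorem Polynomial.tendsto_logDeriv_cobounded (p : ℂ[X]) :
    Tendsto (logDeriv fun t => p.eval t) (Bornology.cobounded ℂ) (𝓝 0) := by
  rcases eq_or_ne p 0 with rfl | hp
  · simp [logDeriv, Pi.div_def]
  have hroots : Tendsto (fun t : ℂ => (p.roots.map fun z => 1 / (t - z)).sum)
      (Bornology.cobounded ℂ) (𝓝 0) := by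
    have h := tendsto_multiset_sum (f := fun z t : ℂ => 1 / (t - z)) (a := fun _ => 0) p.roots
      fun z _ => by
        simpa [Function.comp_def] using
          tendsto_inv₀_cobounded.comp (tendsto_sub_const_cobounded z)
    simpa using h
  refine hroots.congr' ?_
  filter_upwards [Polynomial.eventually_cobounded_eval_ne_zero hp] with t ht
  rw [logDeriv_apply, Polynomial.deriv,
    (IsAlgClosed.splits p).eval_derivative_div_eval_of_ne_zero ht]

theorem evalR_eq_div (f : RatFunc ℂ) :
    evalR f = fun t => f.num.eval t / f.denom.eval t := rfl

theorem eventually_definedAt (f : RatFunc ℂ) :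
    ∀ᶠ t in Bornology.cobounded ℂ, DefinedAt f t :=
  Polynomial.eventually_cobounded_eval_ne_zero f.denom_ne_zero

theorem evalR_add {f g : RatFunc ℂ} {t : ℂ} (hf : DefinedAt f t) (hg : DefinedAt g t) :
    evalR (f + g) t = evalR f t + evalR g t :=
  RatFunc.eval_add (RingHom.id ℂ) t hf hg

theorem DefinedAt.add {f g : RatFunc ℂ} {t : ℂ} (hf : DefinedAt f t) (hg : DefinedAt g t) :
    DefinedAt (f + g) t := by
  intro h
  have := Polynomial.eval_eq_zero_of_dvd_of_eval_eq_zero (RatFunc.denom_add_dvd f g) h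
  rw [Polynomial.eval_mul] at this
  exact (mul_ne_zero hf hg) this

theorem tendsto_logDeriv_evalR {f : RatFunc ℂ} (hf : f ≠ 0) :
    Tendsto (logDeriv (evalR f)) (Bornology.cobounded ℂ) (𝓝 0) := by
  have h := (Polynomial.tendsto_logDeriv_cobounded f.num).sub
    (Polynomial.tendsto_logDeriv_cobounded f.denom)
  rw [sub_zero] at h
  refine h.congr' ?_
  filter_upwards [Polynomial.eventually_cobounded_eval_ne_zero (RatFunc.num_ne_zero hf),
    Polynomial.eventually_cobounded_eval_ne_zero f.denom_ne_zero] with t hn hd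
  rw [evalR_eq_div, logDeriv_div t hn hd f.num.differentiableAt f.denom.differentiableAt]

theorem PoleAtInfty.ne_zero {f : RatFunc ℂ} (hf : PoleAtInfty f) : f ≠ 0 := by
  rintro rfl
  obtain ⟨t, ht⟩ := (hf.eventually_gt_atTop 0).exists
  simp [evalR] at ht

theorem HoloAtInfty.isBigO_one {f : RatFunc ℂ} (hf : HoloAtInfty f) :
    evalR f =O[Bornology.cobounded ℂ] (fun _ => (1 : ℂ)) :=
  IsBoundedUnder.isBigO_one ℂ hf

theorem PoleAtInfty.not_isBigO_one {f : RatFunc ℂ} (hf : PoleAtInfty f) :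
    ¬ evalR f =O[Bornology.cobounded ℂ] (fun _ => (1 : ℂ)) := fun h =>
  not_isBoundedUnder_of_tendsto_atTop hf ((Asymptotics.isBigO_one_iff ℂ).1 h)

theorem IsA5Solution.add_add_eq_X {α : Fin 6 → ℂ} {f : Fin 6 → RatFunc ℂ}
    (h : IsA5Solution α f) (i : Fin 6) : f (i + 1) + f (i + 3) + f (i + 5) = RatFunc.X := by
  obtain ⟨h0, h1, -⟩ := h
  fin_cases i
  · exact h1
  · exact (show f 2 + f 4 + f 0 = _ by rw [← h0]; ring)
  · exact (show f 3 + f 5 + f 1 = _ by rw [← h1]; ring)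
  · exact (show f 4 + f 0 + f 2 = _ by rw [← h0]; ring)
  · exact (show f 5 + f 1 + f 3 = _ by rw [← h1]; ring)
  · exact h0

/-- If `f i` has a pole at infinity and `f (i + 2)`, `f (i + 3)`, `f (i + 5)` are holomorphic
there, then the equation for `f i`, divided by `t * f i`, bounds `f (i + 4)`. -/
theorem IsA5Solution.isBigO_one {α : Fin 6 → ℂ} {f : Fin 6 → RatFunc ℂ}
    (h : IsA5Solution α f) {i : Fin 6} (h0 : PoleAtInfty (f i)) (h2 : HoloAtInfty (f (i + 2)))
    (h3 : HoloAtInfty (f (i + 3))) (h5 : HoloAtInfty (f (i + 5))) :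
    evalR (f (i + 4)) =O[Bornology.cobounded ℂ] (fun _ => (1 : ℂ)) := by
  have hconst (c : ℂ) : (fun _ => c) =O[Bornology.cobounded ℂ] (fun _ => (1 : ℂ)) :=
    Asymptotics.isBigO_const_const c one_ne_zero _
  have hinv : Tendsto (fun t : ℂ => t⁻¹) (Bornology.cobounded ℂ) (𝓝 0) := tendsto_inv₀_cobounded
  have hinv0 : Tendsto (fun t => (evalR (f i) t)⁻¹) (Bornology.cobounded ℂ) (𝓝 0) :=
    tendsto_inv₀_cobounded.comp (tendsto_norm_atTop_iff_cobounded.1 h0)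
  have b0 := hinv0.isBigO_one ℂ
  have bt := hinv.isBigO_one ℂ
  have b2 := h2.isBigO_one
  have b3 := h3.isBigO_one
  have b5 := h5.isBigO_one
  have bL := (tendsto_logDeriv_evalR h0.ne_zero).isBigO_one ℂ
  -- the coefficient of `f (i + 4)` tends to `1`
  set u : ℂ → ℂ := fun t =>
    1 + (α i * (evalR (f i) t)⁻¹ - 2 * evalR (f (i + 5)) t) * t⁻¹ with hu
  have hu1 : Tendsto u (Bornology.cobounded ℂ) (𝓝 1) := by
    have hb : (fun t => α i * (evalR (f i) t)⁻¹ - 2 * evalR (f (i + 5)) t)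
        =O[Bornology.cobounded ℂ] (fun _ => (1 : ℂ)) :=
      (b0.const_mul_left _).sub (b5.const_mul_left _)
    have ho := hb.mul_isLittleO ((Asymptotics.isLittleO_one_iff ℂ).2 hinv)
    simp only [mul_one] at ho
    simpa [hu] using ((Asymptotics.isLittleO_one_iff ℂ).1 ho).const_add 1
  have huinv : (fun t => (u t)⁻¹) =O[Bornology.cobounded ℂ] (fun _ => (1 : ℂ)) :=
    (hu1.inv₀ one_ne_zero).isBigO_one ℂ
  have mul1 {a b : ℂ → ℂ} (ha : a =O[Bornology.cobounded ℂ] (fun _ => (1 : ℂ)))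
      (hb : b =O[Bornology.cobounded ℂ] (fun _ => (1 : ℂ))) :
      (fun t => a t * b t) =O[Bornology.cobounded ℂ] (fun _ => (1 : ℂ)) := by
    simpa using ha.mul hb
  have hR : (fun t => ((1 / 2 * logDeriv (evalR (f i)) t - evalR (f (i + 2)) t)
      + (2 * (evalR (f (i + 2)) t * (evalR (f (i + 3)) t + evalR (f (i + 5)) t))
        - (1 / 2 - α (i + 2) - α (i + 4))
        - α i * (evalR (f (i + 2)) t * (evalR (f i) t)⁻¹)) * t⁻¹) * (u t)⁻¹)
      =O[Bornology.cobounded ℂ] (fun _ => (1 : ℂ)) :=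
    mul1 (((bL.const_mul_left _).sub b2).add
      (mul1 ((((mul1 b2 (b3.add b5)).const_mul_left _).sub (hconst _)).sub
        ((mul1 b2 b0).const_mul_left _)) bt)) huinv
  refine hR.congr' ?_ EventuallyEq.rfl
  filter_upwards [eventually_all.2 fun j => eventually_definedAt (f j),
    h0.eventually_gt_atTop 0, hu1.eventually_ne one_ne_zero,
    Bornology.eventually_ne_cobounded (0 : ℂ)] with t hdef hpos hut ht
  have hf0 : evalR (f i) t ≠ 0 := norm_pos_iff.1 hpos
  have hX : evalR (f (i + 1)) t + evalR (f (i + 3)) t + evalR (f (i + 5)) t = t := by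
    rw [← evalR_add (hdef _) (hdef _), ← evalR_add ((hdef _).add (hdef _)) (hdef _),
      h.add_add_eq_X i, evalR, RatFunc.eval_X]
  have hode := h.2.2 t hdef i
  rw [← div_eq_mul_inv, div_eq_iff hut, hu, logDeriv_apply]
  rw [← eq_sub_iff_add_eq, ← eq_sub_iff_add_eq] at hX
  rw [hX] at hode
  field_simp
  linear_combination 2 * hode

/-- Nonexistence of rational solutions with the given pole configuration at `t = ∞`. -/
theorem stmt_6 (α : Fin 6 → ℂ)
    (hsum : α 0 + α 1 + α 2 + α 3 + α 4 + α 5 = 1) :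
    ¬ ∃ (f : Fin 6 → RatFunc ℂ) (i : Fin 6), IsA5Solution α f ∧
      PoleAtInfty (f i) ∧
      PoleAtInfty (f (i + 1)) ∧
      PoleAtInfty (f (i + 4)) ∧
      HoloAtInfty (f (i + 2)) ∧
      HoloAtInfty (f (i + 3)) ∧
      HoloAtInfty (f (i + 5)) := by
  rintro ⟨f, i, hf, h0, -, h4, h2, h3, h5⟩
  exact h4.not_isBigO_one (hf.isBigO_one h0 h2 h3 h5)
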